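/- For every solution P = (E_P, λ_P) of the instance I' and every j ∈ {1,...,k}, P cuts exactly one edge between the root r of T and the root of a vertex-gadget S_{v_i^j} corresponding to a vertex of color class C_j, and λ_P assigns the resulting substar of S_{v_i^j} to group G_j. -/

import Mathlib

namespace MCC

/-- `k₀ = k + C(k,2)`. -/
def k0 (k : ℕ) : ℕ := k + Nat.choose k 2

/-- `K = k + 3·C(k,2)`, the cut budget. -/
def KK (k : ℕ) : ℕ := k + 3 * Nat.choose k 2

/-- `z = k₀² · n⁵`. -/
def z (k n : ℕ) : ℕ := (k0 k)^2 * n^5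

/-- `b_j = k₀^{2j} · z` (`j` is 1-based). -/
def bb (k n j : ℕ) : ℕ := (k0 k)^(2*j) * z k n

/-- `c_j = k₀^{2(k+j)} · z` (`j` is 1-based). -/
def cc (k n j : ℕ) : ℕ := (k0 k)^(2*(k+j)) * z k n

/-- `c_j^q = c_k · k₀^{2((j−1)k − j(j−1)/2 + q − j)}` (`j, q` are 1-based, `j < q`). -/
def cjq (k n j q : ℕ) : ℕ := cc k n k * (k0 k)^(2*((j-1)*k - j*(j-1)/2 + q - j))

/-- The number of vertices of each copy of the star `S_fix`: `c_{k−1}^k + K + 1`. -/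
def fixSize (k n : ℕ) : ℕ := cjq k n (k-1) k + KK k + 1

/-- The number of vertices of the vertex-gadget star `S_{v_i^j}`:
`c_j − (k−1)·b_j − (k−1)·x_i`, for the vertex `v = (j, i)`. -/
def vgSize (k n : ℕ) (x : Fin n → ℕ) (v : Fin k × Fin n) : ℕ :=
  cc k n (v.1.1 + 1) - (k-1) * bb k n (v.1.1 + 1) - (k-1) * x v.2

/-- The number of vertices of the star `S'_{v_i^j}`: `b_j + x_i`, for the vertex `v = (j, i)`. -/
def spSize (k n : ℕ) (x : Fin n → ℕ) (v : Fin k × Fin n) : ℕ := bb k n (v.1.1 + 1) + x v.2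

/-- Index type for the edges of `M`: ordered pairs of adjacent vertices, with the endpoint of
smaller color first. Each edge of `M` appears exactly once (the coloring being proper). -/
def EIdx (k n : ℕ) (M : SimpleGraph (Fin k × Fin n)) : Type :=
  {p : (Fin k × Fin n) × (Fin k × Fin n) // M.Adj p.1 p.2 ∧ p.1.1 < p.2.1}

/-- The number of vertices of the star `S_e` of the edge-gadget `T_e`: `c_j^q` for an edge `e`
between color classes `j < q`. -/
def seSize (k n : ℕ) {M : SimpleGraph (Fin k × Fin n)} (e : EIdx k n M) : ℕ :=
  cjq k n (e.1.1.1.1 + 1) (e.1.2.1.1 + 1)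

/-- The vertex type of the tree `T` of the instance `I'`: the root `r` (the `Unit` summand);
for each vertex `v` of `M` the star `S_v` (root `none`, leaves `some _`); for each edge `e`
of `M` the edge-gadget `T_e` consisting of the star `S_e` and the two stars `S'` attached to
its two endpoints; and `K+1` copies of the star `S_fix`. -/
abbrev VV (k n : ℕ) (x : Fin n → ℕ) (M : SimpleGraph (Fin k × Fin n)) : Type :=
  Unit ⊕
  (Σ v : Fin k × Fin n, Option (Fin (vgSize k n x v - 1))) ⊕
  (Σ e : EIdx k n M,
    (Option (Fin (seSize k n e - 1)) ⊕ Option (Fin (spSize k n x e.1.1 - 1)) ⊕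
      Option (Fin (spSize k n x e.1.2 - 1)))) ⊕
  (Fin (KK k + 1) × Option (Fin (fixSize k n - 1)))

/-- Classify a vertex of an edge-gadget: which of the three stars it belongs to
(`0` for `S_e`, `1` and `2` for the two `S'`-stars) and whether it is that star's root. -/
def code {A B C : Type} : (Option A ⊕ Option B ⊕ Option C) → ℕ × Bool
  | Sum.inl none => (0, true)
  | Sum.inl (some _) => (0, false)
  | Sum.inr (Sum.inl none) => (1, true)
  | Sum.inr (Sum.inl (some _)) => (1, false)
  | Sum.inr (Sum.inr none) => (2, true)
  | Sum.inr (Sum.inr (some _)) => (2, false)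

/-- Adjacency inside an edge-gadget `T_e`: the root `r_e` of `S_e` is joined to the leaves of
`S_e` and to the roots of the two `S'`-stars, and the root of each `S'`-star is joined to
its leaves. -/
def codeRel : ℕ × Bool → ℕ × Bool → Prop
  | (0, true), (0, false) => True
  | (0, true), (1, true) => True
  | (0, true), (2, true) => True
  | (1, true), (1, false) => True
  | (2, true), (2, false) => True
  | _, _ => False

/-- The (directed) edge relation of the tree `T` of the instance `I'`. -/
def relMCC (k n : ℕ) (x : Fin n → ℕ) (M : SimpleGraph (Fin k × Fin n)) :
    VV k n x M → VV k n x M → Prop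
  | Sum.inl _, Sum.inr (Sum.inl ⟨_, d⟩) => d = none
  | Sum.inr (Sum.inl ⟨u, d⟩), Sum.inr (Sum.inl ⟨u', d'⟩) => u = u' ∧ d = none ∧ d' ≠ none
  | Sum.inl _, Sum.inr (Sum.inr (Sum.inl ⟨_, d⟩)) => code d = (0, true)
  | Sum.inr (Sum.inr (Sum.inl ⟨e, d⟩)), Sum.inr (Sum.inr (Sum.inl ⟨e', d'⟩)) =>
      e = e' ∧ codeRel (code d) (code d')
  | Sum.inl _, Sum.inr (Sum.inr (Sum.inr (_, d))) => d = none
  | Sum.inr (Sum.inr (Sum.inr (c, d))), Sum.inr (Sum.inr (Sum.inr (c', d'))) =>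
      c = c' ∧ d = none ∧ d' ≠ none
  | _, _ => False

/-- The tree `T` of the instance `I'`. -/
def TG (k n : ℕ) (x : Fin n → ℕ) (M : SimpleGraph (Fin k × Fin n)) : SimpleGraph (VV k n x M) :=
  SimpleGraph.fromRel (relMCC k n x M)

/-- The root `r` of `T`. -/
def rootT (k n : ℕ) (x : Fin n → ℕ) (M : SimpleGraph (Fin k × Fin n)) : VV k n x M :=
  Sum.inl ()

/-- The root `r_{v_i^j}` of the vertex-gadget star `S_{v_i^j}`. -/
def vgRoot (k n : ℕ) (x : Fin n → ℕ) (M : SimpleGraph (Fin k × Fin n)) (v : Fin k × Fin n) :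
    VV k n x M :=
  Sum.inr (Sum.inl ⟨v, none⟩)

/-- The root `r_e` of the star `S_e` of the edge-gadget `T_e`. -/
def seRoot (k n : ℕ) (x : Fin n → ℕ) {M : SimpleGraph (Fin k × Fin n)} (e : EIdx k n M) :
    VV k n x M :=
  Sum.inr (Sum.inr (Sum.inl ⟨e, Sum.inl none⟩))

/-- The root `r'_{v_i^j}` of the star `S'` of the lower-colored endpoint of `e`. -/
def sp1Root (k n : ℕ) (x : Fin n → ℕ) {M : SimpleGraph (Fin k × Fin n)} (e : EIdx k n M) :
    VV k n x M :=
  Sum.inr (Sum.inr (Sum.inl ⟨e, Sum.inr (Sum.inl none)⟩))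

/-- The root `r'_{v_p^q}` of the star `S'` of the higher-colored endpoint of `e`. -/
def sp2Root (k n : ℕ) (x : Fin n → ℕ) {M : SimpleGraph (Fin k × Fin n)} (e : EIdx k n M) :
    VV k n x M :=
  Sum.inr (Sum.inr (Sum.inl ⟨e, Sum.inr (Sum.inr none)⟩))

/-- The vertex set of the vertex-gadget star `S_v`. -/
def vgSet (k n : ℕ) (x : Fin n → ℕ) (M : SimpleGraph (Fin k × Fin n)) (v : Fin k × Fin n) :
    Set (VV k n x M) :=
  {w | ∃ d, w = Sum.inr (Sum.inl ⟨v, d⟩)}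

/-- The vertex set of the star `S_e` of the edge-gadget `T_e`. -/
def SeSet (k n : ℕ) (x : Fin n → ℕ) {M : SimpleGraph (Fin k × Fin n)} (e : EIdx k n M) :
    Set (VV k n x M) :=
  {w | ∃ d, w = Sum.inr (Sum.inr (Sum.inl ⟨e, Sum.inl d⟩))}

/-- The groups of the instance `I'`: the groups `G_1, …, G_k`, the groups `G_j^q` for
`1 ≤ j < q ≤ k`, and the group `G_rest`. -/
abbrev Grp (k : ℕ) : Type := Fin k ⊕ {pq : Fin k × Fin k // pq.1 < pq.2} ⊕ Unit

/-- The group `G_j`. -/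
def gCol {k : ℕ} (j : Fin k) : Grp k := Sum.inl j

/-- The group `G_j^q`. -/
def gPair {k : ℕ} (pq : {pq : Fin k × Fin k // pq.1 < pq.2}) : Grp k := Sum.inr (Sum.inl pq)

/-- The group `G_rest`. -/
def gRest (k : ℕ) : Grp k := Sum.inr (Sum.inr ())

/-- `t = |V(T)|`. -/
noncomputable def tTot (k n : ℕ) (x : Fin n → ℕ) (M : SimpleGraph (Fin k × Fin n)) : ℕ :=
  (Set.univ : Set (VV k n x M)).ncard

/-- `t' = t − Σ_j c_j − Σ_{j<q} c_j^q`, the size of the group `G_rest`. -/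
noncomputable def tRest (k n : ℕ) (x : Fin n → ℕ) (M : SimpleGraph (Fin k × Fin n)) : ℕ :=
  tTot k n x M - (∑ j : Fin k, cc k n (j.1 + 1)) -
    ∑ pq : {pq : Fin k × Fin k // pq.1 < pq.2}, cjq k n (pq.1.1.1 + 1) (pq.1.2.1 + 1)

/-- The prescribed sizes of the groups: `G_j` has size `c_j`, `G_j^q` has size `c_j^q`,
and `G_rest` has size `t'`. -/
noncomputable def sizesMCC (k n : ℕ) (x : Fin n → ℕ) (M : SimpleGraph (Fin k × Fin n)) :
    Grp k → ℕ
  | Sum.inl j => cc k n (j.1 + 1)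
  | Sum.inr (Sum.inl pq) => cjq k n (pq.1.1.1 + 1) (pq.1.2.1 + 1)
  | Sum.inr (Sum.inr _) => tRest k n x M

/-- A solution cutting at most `kk` edges: `EP` is a set of at most `kk` edges of `T`, and
`lam` assigns the connected components of `T − EP` to the groups (it is constant on each
component) so that each group `g` receives exactly `sizes g` vertices. -/
def IsSolutionLe {V G : Type} (T : SimpleGraph V) (EP : Set (Sym2 V)) (kk : ℕ)
    (sizes : G → ℕ) (lam : V → G) : Prop :=
  EP ⊆ T.edgeSet ∧ EP.ncard ≤ kk ∧
    (∀ v w : V, (T.deleteEdges EP).Reachable v w → lam v = lam w) ∧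
    ∀ g : G, {v | lam v = g}.ncard = sizes g

/-- `C` is a `P`-component: a connected component of `T − EP`. -/
def IsPComp {V : Type} (T : SimpleGraph V) (EP : Set (Sym2 V)) (C : Set V) : Prop :=
  ∃ v : V, C = {w | (T.deleteEdges EP).Reachable v w}

/-- `M` contains a multicolored `k`-clique: one vertex of each color class, pairwise adjacent. -/
def HasMCClique (k n : ℕ) (M : SimpleGraph (Fin k × Fin n)) : Prop :=
  ∃ sel : Fin k → Fin n, ∀ j j' : Fin k, j ≠ j' → M.Adj (j, sel j) (j', sel j')

/-- The instance `I'` has a solution. -/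
def HasSol (k n : ℕ) (x : Fin n → ℕ) (M : SimpleGraph (Fin k × Fin n)) : Prop :=
  ∃ (EP : Set (Sym2 (VV k n x M))) (lam : VV k n x M → Grp k),
    IsSolutionLe (TG k n x M) EP (KK k) (sizesMCC k n x M) lam

end MCC

namespace MCC

section aux

def NN (k : ℕ) : ℕ := (k0 k)^2

def pos (k a b : ℕ) : ℕ := (a+1-1)*k - (a+1)*(a+1-1)/2 + (b+1) - (a+1)

def gpos (k a : ℕ) : ℕ := a*k - (a+1)*a/2

lemma half_le (k a : ℕ) (h : a < k) : (a+1)*a/2 ≤ a*k := by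
  have : (a+1)*a ≤ a*k := by nlinarith
  exact (Nat.div_le_self _ _).trans this

lemma gpos_succ (k a : ℕ) (h : a + 1 < k) : gpos k (a+1) = gpos k a + (k - (a+1)) := by
  unfold gpos
  have h1 := half_le k a (by omega)
  have h2 : (a+1+1)*(a+1)/2 = (a+1)*a/2 + (a+1) := by
    have : (a+1+1)*(a+1) = (a+1)*a + (a+1)*2 := by ring
    rw [this, Nat.add_mul_div_right _ _ (by norm_num)]
  have h3 : (a+1)*k = a*k + k := by ring
  rw [h2, h3]
  omega

lemma gpos_lt (k a a' : ℕ) (h : a < a') (h' : a' < k) : gpos k a + (k - (a+1)) ≤ gpos k a' := by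
  induction a' with
  | zero => omega
  | succ m ih =>
    rw [gpos_succ k m h']
    rcases Nat.lt_or_ge a m with h1 | h1
    · have := ih h1 (by omega)
      omega
    · have : a = m := by omega
      subst this
      exact le_rfl

lemma pos_eq (k a b : ℕ) (h : a < b) : pos k a b = gpos k a + (b - a) := by
  unfold pos gpos
  simp only [Nat.add_sub_cancel]
  omega

lemma pos_lex (k a b a' b' : ℕ) (hb : b < k) (h : a < b) (hb' : b' < k) (h' : a' < b')
    (haa : a < a') : pos k a b < pos k a' b' := by
  rw [pos_eq k a b h, pos_eq k a' b' h']
  have := gpos_lt k a a' haa (by omega)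
  omega

lemma pos_inj (k a b a' b' : ℕ) (hb : b < k) (h : a < b) (hb' : b' < k) (h' : a' < b')
    (he : pos k a b = pos k a' b') : a = a' ∧ b = b' := by
  rcases Nat.lt_trichotomy a a' with h1 | h1 | h1
  · have := pos_lex k a b a' b' hb h hb' h' h1
    omega
  · subst h1
    rw [pos_eq k a b h, pos_eq k a b' h'] at he
    omega
  · have := pos_lex k a' b' a b hb' h' hb h h1
    omega

lemma pos_max (k a b : ℕ) (hb : b < k) (h : a < b) : pos k a b ≤ pos k (k-2) (k-1) := by
  rcases Nat.lt_or_ge a (k-2) with h1 | h1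
  · exact (pos_lex k a b (k-2) (k-1) hb h (by omega) (by omega) h1).le
  · have h2 : a = k - 2 := by omega
    have h3 : b = k - 1 := by omega
    rw [h2, h3]

lemma pos_pos (k a b : ℕ) (h : a < b) : 1 ≤ pos k a b := by
  rw [pos_eq k a b h]; omega

lemma cc_eq (k n j : ℕ) : cc k n j = NN k ^ (k+j) * z k n := by
  unfold cc NN; rw [pow_mul]

lemma bb_eq (k n j : ℕ) : bb k n j = NN k ^ j * z k n := by
  unfold bb NN; rw [pow_mul]

lemma cjq_eq (k n a b : ℕ) : cjq k n (a+1) (b+1) = cc k n k * NN k ^ pos k a b := by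
  unfold cjq NN pos; rw [pow_mul]

lemma choose_pos (k : ℕ) (hk : 2 ≤ k) : 1 ≤ Nat.choose k 2 := Nat.choose_pos hk

lemma K_le (k : ℕ) (hk : 2 ≤ k) : KK k + 4 ≤ NN k := by
  have := choose_pos k hk
  unfold KK NN k0
  nlinarith

lemma k_le (k : ℕ) : k ≤ KK k := by unfold KK; omega

lemma K_ge (k : ℕ) (hk : 2 ≤ k) : 5 ≤ KK k := by
  have := choose_pos k hk
  unfold KK; omega

lemma N_le_z (k n : ℕ) (hn : 1 ≤ n) : NN k ≤ z k n := by
  unfold z NN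
  exact Nat.le_mul_of_pos_right _ (by positivity)

lemma n4_le_z (k n : ℕ) (hk : 2 ≤ k) (hn : 1 ≤ n) : n^4 ≤ z k n := by
  have h1 : n^4 ≤ n^5 := Nat.pow_le_pow_right hn (by norm_num)
  have h2 : 0 < NN k := by have := K_le k hk; omega
  calc n^4 ≤ n^5 := h1
    _ ≤ NN k * n^5 := Nat.le_mul_of_pos_left _ h2
    _ = z k n := rfl

/-- monotonicity of powers -/
lemma NP (k : ℕ) (hk : 2 ≤ k) {a b : ℕ} (h : a ≤ b) : NN k ^ a ≤ NN k ^ b :=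
  Nat.pow_le_pow_right (by have := K_le k hk; omega) h

lemma bb_le (k n j : ℕ) (hk : 2 ≤ k) (hj : j ≤ k) : bb k n j ≤ bb k n k := by
  rw [bb_eq, bb_eq]
  exact Nat.mul_le_mul_right _ (NP k hk hj)

lemma cc_le (k n : ℕ) {j j' : ℕ} (hk : 2 ≤ k) (hj : j ≤ j') : cc k n j ≤ cc k n j' := by
  rw [cc_eq, cc_eq]
  exact Nat.mul_le_mul_right _ (NP k hk (by omega))

lemma z_le_bb (k n j : ℕ) (hk : 2 ≤ k) (hj : 1 ≤ j) : NN k * z k n ≤ bb k n j := by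
  rw [bb_eq]
  apply Nat.mul_le_mul_right
  calc NN k = NN k ^ 1 := (pow_one _).symm
    _ ≤ _ := NP k hk hj

lemma bbk_cc (k n j : ℕ) (hk : 2 ≤ k) (hj : 1 ≤ j) : NN k * bb k n k ≤ cc k n j := by
  rw [bb_eq, cc_eq, ← mul_assoc, ← pow_succ']
  exact Nat.mul_le_mul_right _ (NP k hk (by omega))

lemma cc_succ (k n j : ℕ) : cc k n (j+1) = NN k * cc k n j := by
  rw [cc_eq, cc_eq, ← mul_assoc, ← pow_succ']; rfl

lemma cc_bb (k n j : ℕ) (hk : 2 ≤ k) : NN k * (NN k * bb k n j) ≤ cc k n j := by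
  have e : NN k * (NN k * bb k n j) = NN k ^ (2+j) * z k n := by rw [bb_eq]; ring
  rw [e, cc_eq]
  exact Nat.mul_le_mul_right _ (NP k hk (by omega))

lemma vg_low (k n : ℕ) (hk : 2 ≤ k) (hn : 1 ≤ n) (x : ℕ) (hx : x ≤ n^4) (j j' : ℕ) (hj : 1 ≤ j)
    (hjj : j < j') : cc k n j + KK k < cc k n j' - (k-1) * bb k n j' - (k-1) * x := by
  have h1 : NN k * cc k n j ≤ cc k n j' := by
    rw [← cc_succ]; exact cc_le k n hk hjj
  have h2 := cc_bb k n j' hk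
  have h3 := z_le_bb k n j' hk (by omega)
  have h4 := n4_le_z k n hk hn
  have h5 := K_le k hk
  have h6 := N_le_z k n hn
  have h7 := k_le k
  have h8 : (k-1) * bb k n j' ≤ NN k * bb k n j' := Nat.mul_le_mul_right _ (by omega)
  have h9 : (k-1) * x ≤ NN k * z k n := Nat.mul_le_mul (by omega) (by omega)
  have h10 : 9 * cc k n j ≤ NN k * cc k n j := Nat.mul_le_mul_right _ (by have := K_ge k hk; omega)
  have h11 : 9 * (NN k * bb k n j') ≤ NN k * (NN k * bb k n j') :=
    Nat.mul_le_mul_right _ (by have := K_ge k hk; omega)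
  have h12 : 9 * bb k n j' ≤ NN k * bb k n j' := Nat.mul_le_mul_right _ (by have := K_ge k hk; omega)
  have h13 : 9 * z k n ≤ NN k * z k n := Nat.mul_le_mul_right _ (by have := K_ge k hk; omega)
  omega

lemma vg_pos (k n : ℕ) (hk : 2 ≤ k) (hn : 1 ≤ n) (x : ℕ) (hx : x ≤ n^4) (j' : ℕ) (hj : 1 ≤ j') :
    1 ≤ cc k n j' - (k-1) * bb k n j' - (k-1) * x := by
  have h2 := cc_bb k n j' hk
  have h3 := z_le_bb k n j' hk (by omega)
  have h4 := n4_le_z k n hk hn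
  have h5 := K_le k hk
  have h6 := N_le_z k n hn
  have h7 := k_le k
  have h8 : (k-1) * bb k n j' ≤ NN k * bb k n j' := Nat.mul_le_mul_right _ (by omega)
  have h9 : (k-1) * x ≤ NN k * z k n := Nat.mul_le_mul (by omega) (by omega)
  have h11 : 9 * (NN k * bb k n j') ≤ NN k * (NN k * bb k n j') :=
    Nat.mul_le_mul_right _ (by have := K_ge k hk; omega)
  have h12 : 9 * bb k n j' ≤ NN k * bb k n j' := Nat.mul_le_mul_right _ (by have := K_ge k hk; omega)
  have h13 : 9 * z k n ≤ NN k * z k n := Nat.mul_le_mul_right _ (by have := K_ge k hk; omega)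
  omega

/-- the edge stars are much larger than all vertex groups -/
lemma se_low_col (k n : ℕ) (hk : 2 ≤ k) (hn : 1 ≤ n) (j a b : ℕ) (hj : j ≤ k) (hab : a < b) :
    cc k n j + KK k < cjq k n (a+1) (b+1) := by
  rw [cjq_eq]
  have h1 := cc_le k n hk hj
  have h5 := K_le k hk
  have h6 := N_le_z k n hn
  have h2 : z k n ≤ cc k n k := by
    rw [cc_eq]; exact Nat.le_mul_of_pos_left _ (by apply Nat.pow_pos; omega)
  have h3 : NN k ≤ NN k ^ pos k a b := by
    calc NN k = NN k ^ 1 := (pow_one _).symm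
      _ ≤ _ := NP k hk (pos_pos k a b hab)
  have h4 : cc k n k * NN k ≤ cc k n k * NN k ^ pos k a b := Nat.mul_le_mul_left _ h3
  have h7 : cc k n k * 9 ≤ cc k n k * NN k := Nat.mul_le_mul_left _ (by have := K_ge k hk; omega)
  omega

lemma se_low_pair (k n : ℕ) (hk : 2 ≤ k) (hn : 1 ≤ n) (a b a' b' : ℕ)
    (h : pos k a b < pos k a' b') :
    cjq k n (a+1) (b+1) + KK k < cjq k n (a'+1) (b'+1) := by
  rw [cjq_eq, cjq_eq]
  have h5 := K_le k hk
  have h6 := N_le_z k n hn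
  have h2 : z k n ≤ cc k n k := by
    rw [cc_eq]; exact Nat.le_mul_of_pos_left _ (by apply Nat.pow_pos; omega)
  have h3 : NN k * NN k ^ pos k a b ≤ NN k ^ pos k a' b' := by
    rw [← pow_succ']; exact NP k hk h
  have h4 : cc k n k * (NN k * NN k ^ pos k a b) ≤ cc k n k * NN k ^ pos k a' b' :=
    Nat.mul_le_mul_left _ h3
  have h7 : 9 * (cc k n k * NN k ^ pos k a b) ≤ cc k n k * (NN k * NN k ^ pos k a b) := by
    have : 9 ≤ NN k := by have := K_ge k hk; omega
    calc 9 * (cc k n k * NN k ^ pos k a b) ≤ NN k * (cc k n k * NN k ^ pos k a b) :=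
          Nat.mul_le_mul_right _ this
      _ = _ := by ring
  have h8 : cc k n k * 1 ≤ cc k n k * NN k ^ pos k a b :=
    Nat.mul_le_mul_left _ (by apply Nat.pow_pos; omega)
  omega

/-- upper bound for vertex groups -/
lemma col_up (k n : ℕ) (hk : 2 ≤ k) (hn : 1 ≤ n) (j : ℕ) :
    KK k * (NN k ^ (k+j) * z k n + z k n) < cc k n (j+1) := by
  have h5 := K_le k hk
  have h6 := N_le_z k n hn
  have e : cc k n (j+1) = NN k * (NN k ^ (k+j) * z k n) := by rw [cc_succ, cc_eq]
  rw [e]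
  have h7 : NN k * z k n ≤ NN k ^ (k+j) * z k n := by
    apply Nat.mul_le_mul_right
    calc NN k = NN k ^ 1 := (pow_one _).symm
      _ ≤ _ := NP k hk (by omega)
  generalize NN k ^ (k+j) * z k n = A at *
  have h8 : KK k * z k n ≤ NN k * z k n := Nat.mul_le_mul_right _ (by omega)
  have h9 : (KK k + 4) * A ≤ NN k * A := Nat.mul_le_mul_right _ h5
  have h10 : 1 * z k n ≤ NN k * z k n := Nat.mul_le_mul_right _ (by omega)
  have h11 := K_ge k hk
  nlinarith

lemma pair_up (k n : ℕ) (hk : 2 ≤ k) (hn : 1 ≤ n) (p : ℕ) :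
    KK k * (cc k n k * NN k ^ p + 4 * bb k n k) < cc k n k * NN k ^ (p+1) := by
  have h5 := K_le k hk
  have h6 := N_le_z k n hn
  have e : cc k n k * NN k ^ (p+1) = NN k * (cc k n k * NN k ^ p) := by ring
  rw [e]
  have h7 : NN k * bb k n k ≤ cc k n k := bbk_cc k n k hk (by omega)
  have h8 : cc k n k * 1 ≤ cc k n k * NN k ^ p :=
    Nat.mul_le_mul_left _ (by apply Nat.pow_pos; omega)
  have h12 := z_le_bb k n k hk (by omega)
  generalize cc k n k * NN k ^ p = A at *
  have h9 : (KK k + 4) * A ≤ NN k * A := Nat.mul_le_mul_right _ h5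
  have h10 : (KK k + 4) * bb k n k ≤ NN k * bb k n k := Nat.mul_le_mul_right _ h5
  have h11 := K_ge k hk
  have h13 : 1 * z k n ≤ NN k * z k n := Nat.mul_le_mul_right _ (by omega)
  nlinarith

lemma card_pairs (k : ℕ) : Fintype.card {pq : Fin k × Fin k // pq.1 < pq.2} = Nat.choose k 2 := by
  have e : {pq : Fin k × Fin k // pq.1 < pq.2} ≃ Σ q : Fin k, {p : Fin k // p < q} :=
    { toFun := fun s => ⟨s.1.2, s.1.1, s.2⟩
      invFun := fun s => ⟨(s.2.1, s.1), s.2.2⟩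
      left_inv := fun s => rfl
      right_inv := fun s => rfl }
  rw [Fintype.card_congr e, Fintype.card_sigma]
  have : ∀ q : Fin k, Fintype.card {p : Fin k // p < q} = q.1 := by
    intro q
    rw [Fintype.card_subtype]
    rw [← Fin.card_Iio q]
    congr 1
    ext p
    simp
  refine (Finset.sum_congr rfl (g := fun q : Fin k => q.1) fun q _ => ?_).trans ?_
  · convert this q
  rw [Fin.sum_univ_eq_sum_range (fun i => i) k, Finset.sum_range_id, Nat.choose_two_right]

lemma union_bd {V : Type} [Finite V] (S C : Set V) (D : V → Set V) (B : ℕ)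
    (h : ∀ v ∈ S, ∃ c ∈ C, v ∈ D c ∧ (D c).ncard ≤ B) : S.ncard ≤ C.ncard * B := by
  classical
  have := Fintype.ofFinite V
  have h1 : S.toFinset ⊆ (C.toFinset.filter fun c => (D c).ncard ≤ B).biUnion
      fun c => (D c).toFinset := by
    intro v hv
    obtain ⟨c, hc, hv', hb⟩ := h v (by simpa using hv)
    simp only [Finset.mem_biUnion, Finset.mem_filter, Set.mem_toFinset]
    exact ⟨c, ⟨hc, hb⟩, hv'⟩
  rw [Set.ncard_eq_toFinset_card' S, Set.ncard_eq_toFinset_card' C]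
  refine (Finset.card_le_card h1).trans ?_
  refine (Finset.card_biUnion_le_card_mul _ _ B ?_).trans ?_
  · intro c hc
    rw [← Set.ncard_eq_toFinset_card']
    exact (Finset.mem_filter.1 hc).2
  · exact Nat.mul_le_mul_right _ (Finset.card_filter_le _ _)

lemma low_bd {V G ι : Type} [Finite V] [Fintype ι] (Cut : Set V) (lam : V → G) (g : G)
    (f : ι → V) (hf : Function.Injective f) (h : ∀ i, f i ∉ Cut → lam (f i) = g) :
    Fintype.card ι ≤ {v | lam v = g}.ncard + Cut.ncard := by
  have h1 : Set.range f ⊆ {v | lam v = g} ∪ Cut := by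
    rintro _ ⟨i, rfl⟩
    by_cases hc : f i ∈ Cut
    · exact Or.inr hc
    · exact Or.inl (h i hc)
  have h2 : (Set.range f).ncard = Fintype.card ι := by
    rw [← Set.image_univ, Set.ncard_image_of_injective _ hf, Set.ncard_univ, Nat.card_eq_fintype_card]
  rw [← h2]
  exact (Set.ncard_le_ncard h1 (Set.toFinite _)).trans (Set.ncard_union_le _ _)

lemma ncard_range_le' {V ι : Type} [Fintype ι] (f : ι → V) :
    (Set.range f).ncard ≤ Fintype.card ι := by
  rw [← Set.image_univ]
  refine (Set.ncard_image_le (Set.toFinite _)).trans ?_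
  rw [Set.ncard_univ, Nat.card_eq_fintype_card]

end aux

section main

variable {k n : ℕ} {x : Fin n → ℕ} {M : SimpleGraph (Fin k × Fin n)}

instance : Finite (EIdx k n M) := by unfold EIdx; infer_instance

abbrev iV (v : Fin k × Fin n) (d : Option (Fin (vgSize k n x v - 1))) : VV k n x M :=
  Sum.inr (Sum.inl ⟨v, d⟩)

abbrev iE (e : EIdx k n M) (d : Option (Fin (seSize k n e - 1)) ⊕
    Option (Fin (spSize k n x e.1.1 - 1)) ⊕ Option (Fin (spSize k n x e.1.2 - 1))) : VV k n x M :=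
  Sum.inr (Sum.inr (Sum.inl ⟨e, d⟩))

abbrev iF (c : Fin (KK k + 1)) (d : Option (Fin (fixSize k n - 1))) : VV k n x M :=
  Sum.inr (Sum.inr (Sum.inr (c, d)))

lemma iV_inj (v : Fin k × Fin n) : Function.Injective (iV (x := x) (M := M) v) := by
  intro a b h; simpa [iV] using h

lemma iE_inj (e : EIdx k n M) : Function.Injective (iE (x := x) e) := by
  intro a b h; simpa [iE] using h

lemma iF_inj (c : Fin (KK k + 1)) : Function.Injective (iF (n := n) (x := x) (M := M) c) := by
  intro a b h; simpa [iF] using h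

/-- descendants -/
def desc : VV k n x M → Set (VV k n x M)
  | Sum.inl _ => Set.univ
  | Sum.inr (Sum.inl ⟨v, none⟩) => Set.range (iV v)
  | Sum.inr (Sum.inl ⟨v, some a⟩) => {iV v (some a)}
  | Sum.inr (Sum.inr (Sum.inl ⟨e, Sum.inl none⟩)) => Set.range (iE e)
  | Sum.inr (Sum.inr (Sum.inl ⟨e, Sum.inr (Sum.inl none)⟩)) =>
      Set.range (fun d => iE e (Sum.inr (Sum.inl d)))
  | Sum.inr (Sum.inr (Sum.inl ⟨e, Sum.inr (Sum.inr none)⟩)) =>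
      Set.range (fun d => iE e (Sum.inr (Sum.inr d)))
  | Sum.inr (Sum.inr (Sum.inl ⟨e, d⟩)) => {iE e d}
  | Sum.inr (Sum.inr (Sum.inr (c, none))) => Set.range (iF c)
  | Sum.inr (Sum.inr (Sum.inr (c, some a))) => {iF c (some a)}

lemma rel_asymm (p v : VV k n x M) (h : relMCC k n x M p v) (h' : relMCC k n x M v p) : False := by
  rcases p with _ | ⟨u, _ | a⟩ | ⟨e, (_ | a) | (_ | a) | (_ | a)⟩ | ⟨c, _ | a⟩ <;>
  rcases v with _ | ⟨u', _ | a'⟩ | ⟨e', (_ | a') | (_ | a') | (_ | a')⟩ | ⟨c', _ | a'⟩ <;>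
  simp_all [relMCC, code, codeRel]

lemma rel_vg (p : VV k n x M) (v : Fin k × Fin n) (h : relMCC k n x M p (vgRoot k n x M v)) :
    p = rootT k n x M := by
  rcases p with _ | ⟨u, _ | a⟩ | ⟨e, (_ | a) | (_ | a) | (_ | a)⟩ | ⟨c, _ | a⟩ <;>
  simp_all [relMCC, vgRoot, rootT]

/-- abstract data -/
structure Dat (k n : ℕ) (x : Fin n → ℕ) (M : SimpleGraph (Fin k × Fin n))
    (Cut : Set (VV k n x M)) (lam : VV k n x M → Grp k) : Prop where
  hk : 2 ≤ k
  hn : 1 ≤ n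
  hx : ∀ i, x i ≤ n^4
  card : Cut.ncard ≤ KK k
  par : ∀ p v, relMCC k n x M p v → v ∉ Cut → lam v = lam p
  size : ∀ g, {v | lam v = g}.ncard = sizesMCC k n x M g

variable {Cut : Set (VV k n x M)} {lam : VV k n x M → Grp k}

lemma Dat.low (D : Dat k n x M Cut lam) {ι : Type} [Fintype ι] (f : ι → VV k n x M)
    (hf : Function.Injective f) (g : Grp k) (h : ∀ i, f i ∉ Cut → lam (f i) = g) :
    Fintype.card ι ≤ sizesMCC k n x M g + KK k := by
  have := low_bd Cut lam g f hf h
  rw [D.size] at this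
  have := D.card
  omega

lemma Dat.vleaf (D : Dat k n x M Cut lam) (v : Fin k × Fin n) (d) (h : iV v d ∉ Cut) (g : Grp k)
    (hg : lam (iV v none) = g) : lam (iV v d) = g := by
  rcases d with _ | a
  · exact hg
  · rw [← hg]; exact D.par _ _ (by simp [relMCC]) h

lemma Dat.eleaf (D : Dat k n x M Cut lam) (e : EIdx k n M) (d) (h : iE e (Sum.inl d) ∉ Cut)
    (g : Grp k) (hg : lam (iE e (Sum.inl none)) = g) : lam (iE e (Sum.inl d)) = g := by
  rcases d with _ | a
  · exact hg
  · rw [← hg]; exact D.par _ _ (by simp [relMCC, code, codeRel]) h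

lemma Dat.p1leaf (D : Dat k n x M Cut lam) (e : EIdx k n M) (d)
    (h : iE e (Sum.inr (Sum.inl d)) ∉ Cut)
    (g : Grp k) (hg : lam (iE e (Sum.inr (Sum.inl none))) = g) :
    lam (iE e (Sum.inr (Sum.inl d))) = g := by
  rcases d with _ | a
  · exact hg
  · rw [← hg]; exact D.par _ _ (by simp [relMCC, code, codeRel]) h

lemma Dat.p2leaf (D : Dat k n x M Cut lam) (e : EIdx k n M) (d)
    (h : iE e (Sum.inr (Sum.inr d)) ∉ Cut)
    (g : Grp k) (hg : lam (iE e (Sum.inr (Sum.inr none))) = g) :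
    lam (iE e (Sum.inr (Sum.inr d))) = g := by
  rcases d with _ | a
  · exact hg
  · rw [← hg]; exact D.par _ _ (by simp [relMCC, code, codeRel]) h

lemma Dat.fleaf (D : Dat k n x M Cut lam) (c : Fin (KK k + 1)) (d) (h : iF c d ∉ Cut)
    (g : Grp k) (hg : lam (iF c none) = g) : lam (iF c d) = g := by
  rcases d with _ | a
  · exact hg
  · rw [← hg]; exact D.par _ _ (by simp [relMCC]) h

lemma Dat.vlow (D : Dat k n x M Cut lam) (v : Fin k × Fin n) :
    vgSize k n x v ≤ sizesMCC k n x M (lam (iV v none)) + KK k := by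
  have := D.low (iV v) (iV_inj v) _ (fun d h => D.vleaf v d h _ rfl)
  simp only [Fintype.card_option, Fintype.card_fin] at this
  omega

lemma Dat.elow (D : Dat k n x M Cut lam) (e : EIdx k n M) :
    seSize k n e ≤ sizesMCC k n x M (lam (iE e (Sum.inl none))) + KK k := by
  have := D.low (fun d => iE e (Sum.inl d)) (fun a b h => by simpa using iE_inj e h) _
    (fun d h => D.eleaf e d h _ rfl)
  simp only [Fintype.card_option, Fintype.card_fin] at this
  omega

lemma Dat.e1low (D : Dat k n x M Cut lam) (e : EIdx k n M)
    (hc : iE e (Sum.inr (Sum.inl none)) ∉ Cut) :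
    seSize k n e + spSize k n x e.1.1 ≤ sizesMCC k n x M (lam (iE e (Sum.inl none))) + KK k := by
  have hp : lam (iE e (Sum.inr (Sum.inl none))) = lam (iE e (Sum.inl none)) :=
    D.par _ _ (by simp [relMCC, code, codeRel]) hc
  have := D.low (ι := Option (Fin (seSize k n e - 1)) ⊕ Option (Fin (spSize k n x e.1.1 - 1)))
    (fun d => iE e (Sum.elim Sum.inl (fun d => Sum.inr (Sum.inl d)) d))
    (fun a b h => by
      have := iE_inj e h
      rcases a with a | a <;> rcases b with b | b <;> simpa using this) (lam (iE e (Sum.inl none)))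
    (fun d h => by
      rcases d with d | d
      · exact D.eleaf e d h _ rfl
      · exact D.p1leaf e d h _ hp)
  simp only [Fintype.card_option, Fintype.card_fin, Fintype.card_sum] at this
  omega

lemma Dat.e2low (D : Dat k n x M Cut lam) (e : EIdx k n M)
    (hc : iE e (Sum.inr (Sum.inr none)) ∉ Cut) :
    seSize k n e + spSize k n x e.1.2 ≤ sizesMCC k n x M (lam (iE e (Sum.inl none))) + KK k := by
  have hp : lam (iE e (Sum.inr (Sum.inr none))) = lam (iE e (Sum.inl none)) :=
    D.par _ _ (by simp [relMCC, code, codeRel]) hc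
  have := D.low (ι := Option (Fin (seSize k n e - 1)) ⊕ Option (Fin (spSize k n x e.1.2 - 1)))
    (fun d => iE e (Sum.elim Sum.inl (fun d => Sum.inr (Sum.inr d)) d))
    (fun a b h => by
      have := iE_inj e h
      rcases a with a | a <;> rcases b with b | b <;> simpa using this) (lam (iE e (Sum.inl none)))
    (fun d h => by
      rcases d with d | d
      · exact D.eleaf e d h _ rfl
      · exact D.p2leaf e d h _ hp)
  simp only [Fintype.card_option, Fintype.card_fin, Fintype.card_sum] at this
  omega

lemma Dat.flow (D : Dat k n x M Cut lam) (c : Fin (KK k + 1)) :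
    fixSize k n ≤ sizesMCC k n x M (lam (iF c none)) + KK k := by
  have := D.low (iF c) (iF_inj c) _ (fun d h => D.fleaf c d h _ rfl)
  simp only [Fintype.card_option, Fintype.card_fin] at this
  omega

lemma Dat.frest (D : Dat k n x M Cut lam) (c : Fin (KK k + 1)) : lam (iF c none) = gRest k := by
  have h := D.flow c
  have hk := D.hk
  have e1 : k - 1 = (k - 2) + 1 := by omega
  have e2 : k = (k - 1) + 1 := by omega
  have hf : fixSize k n = cjq k n ((k-2)+1) ((k-1)+1) + KK k + 1 := by
    unfold fixSize; rw [← e1, ← e2]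
  have h : cjq k n ((k-2)+1) ((k-1)+1) + KK k + 1 ≤
      sizesMCC k n x M (lam (iF c none)) + KK k := hf.symm.le.trans h
  generalize lam (iF c none) = g at h ⊢
  rcases g with j | pq | u
  · exfalso
    have := se_low_col k n hk D.hn (j.1+1) (k-2) (k-1) j.2 (by omega)
    simp only [sizesMCC] at h
    omega
  · exfalso
    obtain ⟨⟨p, q⟩, hpq⟩ := pq
    have hm := pos_max k p.1 q.1 q.2 hpq
    have : cjq k n (p.1+1) (q.1+1) ≤ cjq k n ((k-2)+1) ((k-1)+1) := by
      rw [cjq_eq, cjq_eq]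
      exact Nat.mul_le_mul_left _ (NP k hk hm)
    simp only [sizesMCC] at h
    omega
  · rfl

lemma Dat.rrest (D : Dat k n x M Cut lam) : lam (rootT k n x M) = gRest k := by
  by_cases h : ∀ c : Fin (KK k + 1), iF c none ∈ Cut
  · exfalso
    have h1 : Set.range (fun c => (iF c none : VV k n x M)) ⊆ Cut := by
      rintro _ ⟨c, rfl⟩; exact h c
    have h2 := Set.ncard_le_ncard h1 (Set.toFinite _)
    rw [← Set.image_univ, Set.ncard_image_of_injective _ (fun a b h => by simpa [iF] using h),
      Set.ncard_univ, Nat.card_eq_fintype_card, Fintype.card_fin] at h2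
    have := D.card
    omega
  · push Not at h
    obtain ⟨c, hc⟩ := h
    rw [← D.frest c]
    exact (D.par _ _ (by simp [relMCC, rootT]) hc).symm

lemma Dat.cover (D : Dat k n x M Cut lam) (v : VV k n x M) (hv : lam v ≠ gRest k) :
    ∃ c ∈ Cut, lam c = lam v ∧ v ∈ desc c := by
  have hr := D.rrest
  -- generic step
  have step : ∀ p v : VV k n x M, relMCC k n x M p v → v ∈ desc v → lam v ≠ gRest k →
      (lam p ≠ gRest k → ∃ c ∈ Cut, lam c = lam p ∧ v ∈ desc c) →
      ∃ c ∈ Cut, lam c = lam v ∧ v ∈ desc c := by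
    intro p v hpv hvv hl hp
    by_cases hc : v ∈ Cut
    · exact ⟨v, hc, rfl, hvv⟩
    · have e := D.par p v hpv hc
      rw [e] at hl ⊢
      exact hp hl
  have top : ∀ v w : VV k n x M, relMCC k n x M (rootT k n x M) v → w ∈ desc v →
      lam v ≠ gRest k → ∃ c ∈ Cut, lam c = lam v ∧ w ∈ desc c := by
    intro v w hv hw hl
    by_cases hc : v ∈ Cut
    · exact ⟨v, hc, rfl, hw⟩
    · exact absurd ((D.par _ v hv hc).trans hr) hl
  have mid : ∀ p v w : VV k n x M, relMCC k n x M (rootT k n x M) p → relMCC k n x M p v →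
      w ∈ desc p → w ∈ desc v →
      lam v ≠ gRest k → ∃ c ∈ Cut, lam c = lam v ∧ w ∈ desc c := by
    intro p v w hp hpv hwp hwv hl
    by_cases hc : v ∈ Cut
    · exact ⟨v, hc, rfl, hwv⟩
    · have e := D.par p v hpv hc
      rw [e] at hl ⊢
      exact top p w hp hwp hl
  rcases v with _ | ⟨u, _ | a⟩ | ⟨e, (_ | a) | (_ | a) | (_ | a)⟩ | ⟨c, _ | a⟩
  · exact absurd hr hv
  · exact top _ _ (by simp [relMCC, rootT]) (by simp [desc]) hv
  · exact step (iV u none) _ (by simp [relMCC]) (by simp [desc]) hv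
      (top _ _ (by simp [relMCC, rootT]) (by simp [desc]))
  · exact top _ _ (by simp [relMCC, rootT, code]) (by simp [desc]) hv
  · exact step (iE e (Sum.inl none)) _ (by simp [relMCC, code, codeRel]) (by simp [desc]) hv
      (top _ _ (by simp [relMCC, rootT, code]) (by simp [desc]))
  · exact mid (iE e (Sum.inl none)) _ _ (by simp [relMCC, rootT, code])
      (by simp [relMCC, code, codeRel]) (by simp [desc]) (by simp [desc]) hv
  · exact step (iE e (Sum.inr (Sum.inl none))) _ (by simp [relMCC, code, codeRel])
      (by simp [desc]) hv
      (mid (iE e (Sum.inl none)) _ _ (by simp [relMCC, rootT, code])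
        (by simp [relMCC, code, codeRel]) (by simp [desc]) (by simp [desc]))
  · exact mid (iE e (Sum.inl none)) _ _ (by simp [relMCC, rootT, code])
      (by simp [relMCC, code, codeRel]) (by simp [desc]) (by simp [desc]) hv
  · exact step (iE e (Sum.inr (Sum.inr none))) _ (by simp [relMCC, code, codeRel])
      (by simp [desc]) hv
      (mid (iE e (Sum.inl none)) _ _ (by simp [relMCC, rootT, code])
        (by simp [relMCC, code, codeRel]) (by simp [desc]) (by simp [desc]))
  · exact top _ _ (by simp [relMCC, rootT]) (by simp [desc]) hv
  · exact step (iF c none) _ (by simp [relMCC]) (by simp [desc]) hv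
      (top _ _ (by simp [relMCC, rootT]) (by simp [desc]))

lemma Dat.up (D : Dat k n x M Cut lam) (g : Grp k) (hg : g ≠ gRest k) (B : ℕ)
    (h : ∀ c ∈ Cut, lam c = g → (desc c).ncard ≤ B) : sizesMCC k n x M g ≤ KK k * B := by
  rw [← D.size]
  refine (union_bd _ Cut desc B ?_).trans (Nat.mul_le_mul_right _ D.card)
  intro v hv
  have hv' : lam v = g := hv
  obtain ⟨c, hc, hl, hd⟩ := D.cover v (by rw [hv']; exact hg)
  exact ⟨c, hc, hd, h c hc (hl.trans hv')⟩

lemma sp_bd (D : Dat k n x M Cut lam) (v : Fin k × Fin n) :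
    spSize k n x v - 1 + 1 ≤ bb k n k + z k n := by
  have h1 := bb_le k n (v.1.1+1) D.hk v.1.2
  have h2 := (D.hx v.2).trans (n4_le_z k n D.hk D.hn)
  have h3 := K_le k D.hk
  have h4 := N_le_z k n D.hn
  unfold spSize
  omega

lemma Dat.desc_cases (D : Dat k n x M Cut lam) (c : VV k n x M) (hc : lam c ≠ gRest k) :
    (∃ v, c = iV v none ∧ (desc c).ncard ≤ cc k n (v.1.1+1)) ∨
    (∃ e, c = iE e (Sum.inl none) ∧ (desc c).ncard ≤ seSize k n e + 4 * bb k n k) ∨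
    (desc c).ncard ≤ bb k n k + z k n := by
  have h3 := K_le k D.hk
  have h4 := N_le_z k n D.hn
  have h5 := z_le_bb k n k D.hk (by have := D.hk; omega)
  have h6 : 1 * z k n ≤ NN k * z k n := Nat.mul_le_mul_right _ (by omega)
  rcases c with _ | ⟨u, _ | a⟩ | ⟨e, (_ | a) | (_ | a) | (_ | a)⟩ | ⟨c, _ | a⟩
  · exact absurd D.rrest hc
  · left
    refine ⟨u, rfl, ?_⟩
    refine (ncard_range_le' _).trans ?_
    have := vg_pos k n D.hk D.hn (x u.2) (D.hx _) (u.1.1+1) (by omega)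
    simp only [Fintype.card_option, Fintype.card_fin]
    change vgSize k n x u - 1 + 1 ≤ _
    have h8 : vgSize k n x u = cc k n (u.1.1+1) - (k-1) * bb k n (u.1.1+1) - (k-1) * x u.2 := rfl
    omega
  · right; right
    simp only [desc, Set.ncard_singleton]; omega
  · right; left
    refine ⟨e, rfl, ?_⟩
    refine (ncard_range_le' _).trans ?_
    have h7 := sp_bd D e.1.1
    have h8 := sp_bd D e.1.2
    have h9 := se_low_col k n D.hk D.hn 0 _ _ (by omega) e.2.2
    simp only [Fintype.card_option, Fintype.card_fin, Fintype.card_sum]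
    have : 1 ≤ seSize k n e := by
      unfold seSize
      exact Nat.lt_of_le_of_lt (Nat.zero_le _) h9
    omega
  · right; right
    simp only [desc, Set.ncard_singleton]; omega
  · right; right
    refine (ncard_range_le' _).trans ?_
    simp only [Fintype.card_option, Fintype.card_fin]
    exact sp_bd D _
  · right; right
    simp only [desc, Set.ncard_singleton]; omega
  · right; right
    refine (ncard_range_le' _).trans ?_
    simp only [Fintype.card_option, Fintype.card_fin]
    exact sp_bd D _
  · right; right
    simp only [desc, Set.ncard_singleton]; omega
  · exact absurd (D.frest c) hc
  · right; right
    simp only [desc, Set.ncard_singleton]; omega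

lemma Dat.pairEx (D : Dat k n x M Cut lam) (pq : {pq : Fin k × Fin k // pq.1 < pq.2}) :
    ∃ e : EIdx k n M, e.1.1.1 = pq.1.1 ∧ e.1.2.1 = pq.1.2 ∧ iE e (Sum.inl none) ∈ Cut ∧
      iE e (Sum.inr (Sum.inl none)) ∈ Cut ∧ iE e (Sum.inr (Sum.inr none)) ∈ Cut := by
  have hk := D.hk
  have h3 := K_le k D.hk
  have h4 := N_le_z k n D.hn
  have h5 : ∀ j, 1 ≤ j → z k n ≤ bb k n j := by
    intro j hj
    have h6 : 1 * z k n ≤ NN k * z k n := Nat.mul_le_mul_right _ (by omega)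
    have := z_le_bb k n j D.hk hj
    omega
  have key : ∃ e : EIdx k n M, e.1.1.1 = pq.1.1 ∧ e.1.2.1 = pq.1.2 ∧ iE e (Sum.inl none) ∈ Cut ∧
      lam (iE e (Sum.inl none)) = gPair pq := by
    by_contra hcon
    push Not at hcon
    have hpos := pos_pos k pq.1.1.1 pq.1.2.1 pq.2
    obtain ⟨m, hm⟩ : ∃ m, pos k pq.1.1.1 pq.1.2.1 = m + 1 := ⟨_, (Nat.sub_add_cancel hpos).symm⟩
    have hs : sizesMCC k n x M (gPair pq) = cjq k n (pq.1.1.1+1) (pq.1.2.1+1) := rfl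
    have hone : cc k n k * 1 ≤ cc k n k * NN k ^ m :=
      Nat.mul_le_mul_left _ (by apply Nat.pow_pos; omega)
    have := D.up (gPair pq) (by simp [gPair, gRest]) (cc k n k * NN k ^ m + 4 * bb k n k) (by
      intro c hc hl
      rcases D.desc_cases c (by rw [hl]; simp [gPair, gRest]) with ⟨v, rfl, h⟩ | ⟨e, rfl, h⟩ | h
      · have := cc_le k n (j := v.1.1+1) (j' := k) hk v.1.2
        omega
      · have hlow := D.elow e
        rw [hl, hs] at hlow
        have hse : seSize k n e = cjq k n (e.1.1.1.1+1) (e.1.2.1.1+1) := rfl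
        rcases Nat.lt_trichotomy (pos k pq.1.1.1 pq.1.2.1) (pos k e.1.1.1.1 e.1.2.1.1) with
          h1 | h1 | h1
        · have := se_low_pair k n hk D.hn _ _ _ _ h1
          omega
        · obtain ⟨h6, h7⟩ := pos_inj k _ _ _ _ pq.1.2.2 pq.2 e.1.2.1.2 e.2.2 h1
          exact absurd hl (hcon e (Fin.ext h6.symm) (Fin.ext h7.symm) hc)
        · rw [cjq_eq] at hse
          have : cc k n k * NN k ^ pos k e.1.1.1.1 e.1.2.1.1 ≤ cc k n k * NN k ^ m :=
            Nat.mul_le_mul_left _ (NP k hk (by omega))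
          omega
      · have := h5 k (by omega)
        omega)
    rw [hs, cjq_eq, hm] at this
    have := pair_up k n hk D.hn m
    omega
  obtain ⟨e, h1, h2, hc, hl⟩ := key
  have hs : sizesMCC k n x M (lam (iE e (Sum.inl none))) = seSize k n e := by
    rw [hl]; unfold seSize; rw [h1, h2]; rfl
  refine ⟨e, h1, h2, hc, ?_, ?_⟩
  · by_contra h
    have := D.e1low e h
    have := h5 (e.1.1.1.1+1) (by omega)
    unfold spSize at *
    omega
  · by_contra h
    have := D.e2low e h
    have := h5 (e.1.2.1.1+1) (by omega)
    unfold spSize at *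
    omega

lemma Dat.colEx (D : Dat k n x M Cut lam) (j : Fin k) :
    ∃ i : Fin n, iV (j, i) none ∈ Cut ∧ lam (iV (j, i) none) = gCol j := by
  by_contra hcon
  push Not at hcon
  have hk := D.hk
  have hs : sizesMCC k n x M (gCol j) = cc k n (j.1+1) := rfl
  have hB := col_up k n hk D.hn j.1
  have := D.up (gCol j) (by simp [gCol, gRest]) (NN k ^ (k+j.1) * z k n + z k n) (by
    intro c hc hl
    rcases D.desc_cases c (by rw [hl]; simp [gCol, gRest]) with ⟨v, rfl, h⟩ | ⟨e, rfl, h⟩ | h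
    · rcases Nat.lt_trichotomy j.1 v.1.1 with h1 | h1 | h1
      · have hlow := D.vlow v
        rw [hl, hs] at hlow
        have := vg_low k n hk D.hn (x v.2) (D.hx _) (j.1+1) (v.1.1+1) (by omega) (by omega)
        unfold vgSize at hlow
        omega
      · obtain ⟨j', i⟩ := v
        have h2 : j = j' := Fin.ext h1
        subst h2
        exact absurd hl (hcon i hc)
      · have := cc_le k n (j := v.1.1+1) (j' := j.1) hk h1
        rw [cc_eq k n j.1] at this
        omega
    · have hlow := D.elow e
      rw [hl, hs] at hlow
      have := se_low_col k n hk D.hn (j.1+1) _ _ j.2 e.2.2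
      exact absurd (lt_of_lt_of_le this hlow) (lt_irrefl _)
    · have : bb k n k ≤ NN k ^ (k+j.1) * z k n := by
        rw [bb_eq]; exact Nat.mul_le_mul_right _ (NP k hk (by omega))
      omega)
  omega

lemma Dat.uniq (D : Dat k n x M Cut lam) (j : Fin k) :
    ∃ i : Fin n, iV (j, i) none ∈ Cut ∧ lam (iV (j, i) none) = gCol j ∧
      ∀ i', iV (j, i') none ∈ Cut → i' = i := by
  choose s hs hl using D.colEx
  choose E he1 he2 hc0 hc1 hc2 using D.pairEx
  let P := {pq : Fin k × Fin k // pq.1 < pq.2}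
  let f : Fin k ⊕ (P ⊕ P ⊕ P) → VV k n x M := fun y => match y with
    | Sum.inl j => iV (j, s j) none
    | Sum.inr (Sum.inl p) => iE (E p) (Sum.inl none)
    | Sum.inr (Sum.inr (Sum.inl p)) => iE (E p) (Sum.inr (Sum.inl none))
    | Sum.inr (Sum.inr (Sum.inr p)) => iE (E p) (Sum.inr (Sum.inr none))
  have hE : ∀ p q, E p = E q → p = q := by
    intro p q h
    apply Subtype.ext
    apply Prod.ext
    · rw [← he1 p, ← he1 q, h]
    · rw [← he2 p, ← he2 q, h]
  have key : ∀ (e e' : EIdx k n M) (d d'), iE (x := x) e d = iE e' d' → e = e' ∧ code d = code d' := by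
    intro e e' d d' h
    simp only [iE, Sum.inr.injEq, Sum.inl.injEq] at h
    cases h
    exact ⟨rfl, rfl⟩
  have hf : Function.Injective f := by
    rintro (a | a | a | a) (b | b | b | b) h <;> simp only [f] at h
    all_goals first
      | (have h' := key _ _ _ _ h
         simp only [code, Prod.mk.injEq] at h'
         first
          | (rw [hE _ _ h'.1]; done)
          | (exact absurd h'.2.1 (by norm_num)))
      | (simp only [iV, Sum.inr.injEq, Sum.inl.injEq] at h
         have := congrArg (fun t => t.1.1) h
         exact congrArg _ this)
      | (exact absurd h (by simp [iV, iE]))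
  have hsub : Set.range f ⊆ Cut := by
    rintro _ ⟨a | a | a | a, rfl⟩
    · exact hs a
    · exact hc0 a
    · exact hc1 a
    · exact hc2 a
  have hcard : (Set.range f).ncard = KK k := by
    rw [← Set.image_univ, Set.ncard_image_of_injective _ hf, Set.ncard_univ,
      Nat.card_eq_fintype_card]
    simp only [Fintype.card_sum, Fintype.card_fin, P, card_pairs]
    unfold KK; omega
  have heq : Set.range f = Cut :=
    Set.eq_of_subset_of_ncard_le hsub (by rw [hcard]; exact D.card) (Set.toFinite _)
  refine ⟨s j, hs j, hl j, ?_⟩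
  intro i' hi'
  rw [← heq] at hi'
  obtain ⟨a | a | a | a, ha⟩ := hi'
  · simp only [f, iV, Sum.inr.injEq, Sum.inl.injEq] at ha
    have h2 : (a, s a) = (j, i') := congrArg (fun t => t.1) ha
    rw [Prod.mk.injEq] at h2
    rw [← h2.2, h2.1]
  all_goals simp [f, iV, iE] at ha

lemma dat_of (hk : 2 ≤ k) (hn : 1 ≤ n) (hx : ∀ i, x i ≤ n^4)
    (EP : Set (Sym2 (VV k n x M))) (lam : VV k n x M → Grp k)
    (hP : IsSolutionLe (TG k n x M) EP (KK k) (sizesMCC k n x M) lam) :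
    Dat k n x M {v | ∃ p, relMCC k n x M p v ∧ s(p, v) ∈ EP} lam := by
  obtain ⟨-, h2, h3, h4⟩ := hP
  refine ⟨hk, hn, hx, ?_, ?_, h4⟩
  · refine le_trans ?_ h2
    classical
    refine Set.ncard_le_ncard_of_injOn
      (fun v => if h : ∃ p, relMCC k n x M p v ∧ s(p, v) ∈ EP then s(h.choose, v) else s(v, v))
      ?_ ?_ (Set.toFinite _)
    · intro v hv
      have hv' : ∃ p, relMCC k n x M p v ∧ s(p, v) ∈ EP := hv
      simp only [dif_pos hv']
      exact hv'.choose_spec.2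
    · intro v hv w hw h
      have hv' : ∃ p, relMCC k n x M p v ∧ s(p, v) ∈ EP := hv
      have hw' : ∃ p, relMCC k n x M p w ∧ s(p, w) ∈ EP := hw
      simp only [dif_pos hv', dif_pos hw'] at h
      have r1 := hv'.choose_spec.1
      have r2 := hw'.choose_spec.1
      rw [Sym2.eq_iff] at h
      rcases h with h | h
      · exact h.2
      · rw [h.1] at r1
        rw [← h.2] at r2
        exact (rel_asymm _ _ r1 r2).elim
  · intro p v hpv hv
    refine (h3 p v ?_).symm
    apply SimpleGraph.Adj.reachable
    rw [SimpleGraph.deleteEdges_adj]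
    refine ⟨?_, fun h => hv ⟨p, hpv, h⟩⟩
    unfold TG
    rw [SimpleGraph.fromRel_adj]
    refine ⟨?_, Or.inl hpv⟩
    rintro rfl
    exact rel_asymm _ _ hpv hpv

end main

end MCC

open MCC

/-- For every solution `P` of `I'` and every color `j`, `P` cuts exactly one edge between
the root `r` of `T` and the root of a vertex-gadget corresponding to a vertex of color class
`C_j`; moreover the resulting substar (the component of that gadget root) is assigned to
group `G_j`. -/
theorem statement7
    (k n : ℕ) (hk : 2 ≤ k) (hn : 1 ≤ n)
    (x : Fin n → ℕ) (hxinj : Function.Injective x) (hxbd : ∀ i, x i ≤ n^4)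
    (hxna : ∀ (g : Fin (k-1) → Fin n) (i : Fin n),
      (∑ j, x (g j)) = (k-1) * x i → ∀ j, x (g j) = x i)
    (M : SimpleGraph (Fin k × Fin n)) (hM : ∀ u w, M.Adj u w → u.1 ≠ w.1)
    (EP : Set (Sym2 (VV k n x M))) (lam : VV k n x M → Grp k)
    (hP : IsSolutionLe (TG k n x M) EP (KK k) (sizesMCC k n x M) lam)
    (j : Fin k) :
    (∃! i : Fin n, s(rootT k n x M, vgRoot k n x M (j, i)) ∈ EP) ∧
    (∀ i : Fin n, s(rootT k n x M, vgRoot k n x M (j, i)) ∈ EP →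
      lam (vgRoot k n x M (j, i)) = gCol j) := by
  have D := dat_of hk hn hxbd EP lam hP
  have hiff : ∀ i, s(rootT k n x M, vgRoot k n x M (j, i)) ∈ EP ↔
      iV (j, i) none ∈ {v | ∃ p, relMCC k n x M p v ∧ s(p, v) ∈ EP} := by
    intro i
    constructor
    · intro h
      exact ⟨_, by simp [relMCC, rootT], h⟩
    · rintro ⟨p, hp, h⟩
      have := rel_vg p (j, i) hp
      rw [this] at h
      exact h
  obtain ⟨i, h1, h2, h3⟩ := D.uniq j
  refine ⟨⟨i, (hiff i).2 h1, fun i' h => h3 i' ((hiff i').1 h)⟩, ?_⟩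
  intro i' h
  rw [h3 i' ((hiff i').1 h)]
  exact h2
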